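/- The map φ defined on generators by φ(X_i) = D_i, φ(D_i) = X_i, φ(T_i) = T_i^{-1}, φ(𝐭) = 𝐭^{-1}, φ(q) = q^{-1} extends to an involutive algebra automorphism of HH_N^{1,+}(q,t) (the subalgebra of HH_N^1(q,t) generated by T_i, X_i, D_i). In particular, the relation D_1X_1 + 1 = qJ_N(X_1D_1 + 1), where J_N = T_1⋯T_{N−1}²⋯T_1, is preserved because J_N·φ(J_N) = 1. -/

import Mathlib

/- STATEMENT 12: The map φ with φ(X_i) = D_i, φ(D_i) = X_i, φ(T_i) = T_i^{-1},
φ(𝐭) = 𝐭^{-1}, φ(q) = q^{-1} extends to an involutive algebra automorphism of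
HH_N^{1,+}(q,t): i.e. the images of the generators satisfy the defining
relations of HH_N^{1,+}(q^{-1},t^{-1}).  In particular, the relation
D_1X_1 + 1 = qJ_N(X_1D_1 + 1) is preserved because J_N·φ(J_N) = 1, where
J_N = T_1⋯T_{N−1}²⋯T_1. -/

section

variable {A : Type*} [Ring A]

/-- T_a T_{a+1} ⋯ T_b (empty product if b + 1 ≤ a) -/
def prodAsc (T : ℕ → A) (a b : ℕ) : A :=
  (((List.range (b + 1 - a)).map (fun j => T (a + j))).prod)

/-- T_b T_{b-1} ⋯ T_a -/
def prodDesc (T : ℕ → A) (a b : ℕ) : A :=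
  (((List.range (b + 1 - a)).reverse.map (fun j => T (a + j))).prod)

/-- the palindromic product T_{j−1}⋯T_{i+1} T_i T_{i+1}⋯T_{j−1}, for i < j -/
def palProd (T : ℕ → A) (i j : ℕ) : A :=
  prodDesc T (i + 1) (j - 1) * T i * prodAsc T (i + 1) (j - 1)

/-- the Jucys–Murphy element J_N = T_1⋯T_{N−1}²⋯T_1 -/
def JM (T : ℕ → A) (N : ℕ) : A :=
  prodAsc T 1 (N - 1) * prodDesc T 1 (N - 1)

end

/-- The presentation of HH_N^{1,+}(q,t) (Theorem `genrel`): Hecke generators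
T_i, commuting X_i, commuting Dunkl elements D_i, and cross relations. -/
structure HH1p (N : ℕ) (q bt : ℂ) (A : Type*) [Ring A] [Algebra ℂ A] where
  T : ℕ → A
  Tinv : ℕ → A
  X : ℕ → A
  D : ℕ → A
  hT : ∀ i, 1 ≤ i → i ≤ N - 1 → T i * Tinv i = 1 ∧ Tinv i * T i = 1
  hecke : ∀ i, 1 ≤ i → i ≤ N - 1 →
    (T i - algebraMap ℂ A bt) * (T i + algebraMap ℂ A bt⁻¹) = 0
  braid : ∀ i, 1 ≤ i → i + 1 ≤ N - 1 → T i * T (i + 1) * T i = T (i + 1) * T i * T (i + 1)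
  Tcomm : ∀ i j, 1 ≤ i → i ≤ N - 1 → 1 ≤ j → j ≤ N - 1 → i + 2 ≤ j → T i * T j = T j * T i
  TXT : ∀ i, 1 ≤ i → i ≤ N - 1 → T i * X i * T i = X (i + 1)
  TXcomm : ∀ i j, 1 ≤ i → i ≤ N - 1 → 1 ≤ j → j ≤ N → j ≠ i → j ≠ i + 1 →
    T i * X j = X j * T i
  TDT : ∀ i, 1 ≤ i → i ≤ N - 1 → D i = T i * D (i + 1) * T i
  TDcomm : ∀ i j, 1 ≤ i → i ≤ N - 1 → 1 ≤ j → j ≤ N → j ≠ i → j ≠ i + 1 →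
    T i * D j = D j * T i
  Xcomm : ∀ i j, 1 ≤ i → i ≤ N → 1 ≤ j → j ≤ N → X i * X j = X j * X i
  Dcomm : ∀ i j, 1 ≤ i → i ≤ N → 1 ≤ j → j ≤ N → D i * D j = D j * D i
  crossLT : ∀ i j, 1 ≤ i → i < j → j ≤ N →
    X i * D j = D j * (prodDesc T (i + 1) (j - 1) * T i * T i * prodAsc Tinv (i + 1) (j - 1)) * X i
      + algebraMap ℂ A (bt - bt⁻¹) * palProd Tinv i j
  crossGT : ∀ i j, 1 ≤ j → j < i → i ≤ N →
    D j * X i = X i * (prodDesc Tinv (j + 1) (i - 1) * Tinv j * Tinv j * prodAsc T (j + 1) (i - 1)) * D j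
      - algebraMap ℂ A (bt - bt⁻¹) * palProd T j i
  main : D 1 * X 1 + 1 = algebraMap ℂ A q * (JM T N * (X 1 * D 1 + 1))

/-- If `S` inverts `T` on `[a, b]`, then descending and ascending products cancel. -/
theorem prodDesc_mul_prodAsc {A : Type*} [Ring A] {T S : ℕ → A} {a b : ℕ}
    (h : ∀ i, a ≤ i → i ≤ b → T i * S i = 1) :
    prodDesc T a b * prodAsc S a b = 1 := by
  have key : ∀ n, a + n ≤ b + 1 →
      ((List.range n).reverse.map fun j => T (a + j)).prod *
        ((List.range n).map fun j => S (a + j)).prod = 1 := by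
    intro n
    induction n generalizing a with
    | zero => simp
    | succ n ih =>
      intro hn
      have ih' := ih (a := a + 1) (fun i hi => h i (by omega)) (by omega)
      have h0 := h a le_rfl (by omega)
      simp only [List.range_succ_eq_map, List.reverse_cons, List.map_append, List.map_cons,
        List.map_nil, List.prod_append, List.prod_cons, List.prod_nil, mul_one, add_zero,
        ← List.map_reverse, List.map_map, Function.comp_def, Nat.succ_eq_add_one]
      simp only [add_assoc, add_comm 1] at ih'
      rw [mul_assoc, ← mul_assoc (T a), h0, one_mul]
      exact ih'
  rcases le_or_gt a (b + 1) with hab | hab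
  · exact key _ (by omega)
  · simp [prodDesc, prodAsc, Nat.sub_eq_zero_of_le hab.le]

/-- If `S` inverts `T` on `[a, b]`, then ascending and descending products cancel. -/
theorem prodAsc_mul_prodDesc {A : Type*} [Ring A] {T S : ℕ → A} {a b : ℕ}
    (h : ∀ i, a ≤ i → i ≤ b → T i * S i = 1) :
    prodAsc T a b * prodDesc S a b = 1 := by
  have key : ∀ n, a + n ≤ b + 1 →
      ((List.range n).map fun j => T (a + j)).prod *
        ((List.range n).reverse.map fun j => S (a + j)).prod = 1 := by
    intro n
    induction n with
    | zero => simp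
    | succ n ih =>
      intro hn
      simp only [List.range_succ, List.reverse_append, List.reverse_singleton, List.map_append,
        List.map_cons, List.map_nil, List.prod_append, List.prod_cons, List.prod_nil, mul_one]
      rw [mul_assoc, ← mul_assoc (T (a + n)), h (a + n) (by omega) (by omega), one_mul]
      exact ih (by omega)
  rcases le_or_gt a (b + 1) with hab | hab
  · exact key _ (by omega)
  · simp [prodDesc, prodAsc, Nat.sub_eq_zero_of_le hab.le]

/-- Inverting the generators inverts the Jucys–Murphy element. -/
theorem JM_mul_JM {A : Type*} [Ring A] {T S : ℕ → A} {N : ℕ}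
    (h : ∀ i, 1 ≤ i → i ≤ N - 1 → T i * S i = 1) : JM T N * JM S N = 1 := by
  unfold JM
  rw [mul_assoc, ← mul_assoc (prodDesc T _ _), prodDesc_mul_prodAsc h, one_mul,
    prodAsc_mul_prodDesc h]

/-- The inverse of a Hecke generator satisfies the quadratic relation with inverted parameter. -/
theorem hecke_inv {A : Type*} [Ring A] [Algebra ℂ A] {c : ℂ} (hc : c ≠ 0) {t s : A}
    (hts : t * s = 1) (hst : s * t = 1)
    (h : (t - algebraMap ℂ A c) * (t + algebraMap ℂ A c⁻¹) = 0) :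
    (s - algebraMap ℂ A c⁻¹) * (s + algebraMap ℂ A c⁻¹⁻¹) = 0 := by
  have hcc : algebraMap ℂ A c⁻¹ * algebraMap ℂ A c = 1 := by
    rw [← map_mul, inv_mul_cancel₀ hc, map_one]
  have com (d : ℂ) (x : A) : algebraMap ℂ A d * x = x * algebraMap ℂ A d :=
    Algebra.commutes d x
  rw [inv_inv]
  have h1 : s - algebraMap ℂ A c⁻¹ = -(algebraMap ℂ A c⁻¹ * (s * (t - algebraMap ℂ A c))) := by
    rw [mul_sub, hst, mul_sub, mul_one, ← com c s, ← mul_assoc, hcc, one_mul, neg_sub]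
  have h2 : s + algebraMap ℂ A c = (t + algebraMap ℂ A c⁻¹) * (s * algebraMap ℂ A c) := by
    rw [add_mul, ← mul_assoc, hts, one_mul, ← com c s, ← mul_assoc, hcc, one_mul, add_comm]
  rw [h1, h2, neg_mul, mul_assoc, mul_assoc, ← mul_assoc (t - _), h]
  simp

/-- Two-sided inverses of elements satisfying the braid relation satisfy it too. -/
theorem braid_inv {M : Type*} [Monoid M] {a b a' b' : M} (ha : a * a' = 1) (ha' : a' * a = 1)
    (hb : b * b' = 1) (hb' : b' * b = 1) (h : a * b * a = b * a * b) :
    a' * b' * a' = b' * a' * b' := by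
  let u : Mˣ := ⟨a, a', ha, ha'⟩
  let v : Mˣ := ⟨b, b', hb, hb'⟩
  have huv : u * v * u = v * u * v := Units.ext h
  have := congrArg Inv.inv huv
  simp only [mul_inv_rev, ← mul_assoc] at this
  exact congrArg Units.val this

/-- A two-sided inverse commutes with whatever the element commutes with. -/
theorem inv_comm_of_comm {M : Type*} [Monoid M] {a a' x : M} (ha : a * a' = 1) (ha' : a' * a = 1)
    (h : a * x = x * a) : a' * x = x * a' :=
  Commute.units_inv_left (u := ⟨a, a', ha, ha'⟩) h

/-- Cancelling a two-sided inverse on both sides of `a * x * a`. -/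
theorem inv_mul_mul_inv {M : Type*} [Monoid M] {a a' x y : M} (ha : a * a' = 1) (ha' : a' * a = 1)
    (h : a * x * a = y) : a' * y * a' = x := by
  rw [← h, mul_assoc a, ← mul_assoc a', ha', one_mul, mul_assoc, ha, mul_one]

theorem statement12 {A : Type*} [Ring A] [Algebra ℂ A] (N : ℕ) (q bt : ℂ)
    (hq : q ≠ 0) (hbt : bt ≠ 0) (h : HH1p N q bt A) :
    (∃ h' : HH1p N q⁻¹ bt⁻¹ A,
        h'.T = h.Tinv ∧ h'.Tinv = h.T ∧ h'.X = h.D ∧ h'.D = h.X) ∧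
      JM h.T N * JM h.Tinv N = 1 := by
  have hl i h1 h2 := (h.hT i h1 h2).1
  have hr i h1 h2 := (h.hT i h1 h2).2
  refine ⟨⟨{
    T := h.Tinv
    Tinv := h.T
    X := h.D
    D := h.X
    hT := fun i h1 h2 => (h.hT i h1 h2).symm
    hecke := fun i h1 h2 => hecke_inv hbt (hl i h1 h2) (hr i h1 h2) (h.hecke i h1 h2)
    braid := fun i h1 h2 =>
      braid_inv (hl i h1 (by omega)) (hr i h1 (by omega)) (hl (i + 1) (by omega) h2)
        (hr (i + 1) (by omega) h2) (h.braid i h1 h2)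
    Tcomm := fun i j h1 h2 h3 h4 h5 =>
      inv_comm_of_comm (hl i h1 h2) (hr i h1 h2)
        (inv_comm_of_comm (hl j h3 h4) (hr j h3 h4) (h.Tcomm i j h1 h2 h3 h4 h5).symm).symm
    TXT := fun i h1 h2 => inv_mul_mul_inv (hl i h1 h2) (hr i h1 h2) (h.TDT i h1 h2).symm
    TXcomm := fun i j h1 h2 h3 h4 h5 h6 =>
      inv_comm_of_comm (hl i h1 h2) (hr i h1 h2) (h.TDcomm i j h1 h2 h3 h4 h5 h6)
    TDT := fun i h1 h2 => (inv_mul_mul_inv (hl i h1 h2) (hr i h1 h2) (h.TXT i h1 h2)).symm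
    TDcomm := fun i j h1 h2 h3 h4 h5 h6 =>
      inv_comm_of_comm (hl i h1 h2) (hr i h1 h2) (h.TXcomm i j h1 h2 h3 h4 h5 h6)
    Xcomm := h.Dcomm
    Dcomm := h.Xcomm
    crossLT := fun i j h1 h2 h3 => by
      rw [h.crossGT j i h1 h2 h3, inv_inv, ← neg_sub bt, map_neg, neg_mul, sub_eq_add_neg]
    crossGT := fun i j h1 h2 h3 => by
      rw [h.crossLT j i h1 h2 h3, inv_inv, ← neg_sub bt, map_neg, neg_mul, sub_neg_eq_add]
    main := by
      rw [h.main, ← Algebra.smul_def, ← Algebra.smul_def, mul_smul_comm, inv_smul_smul₀ hq,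
        ← mul_assoc, JM_mul_JM hr, one_mul] }, rfl, rfl, rfl, rfl⟩, JM_mul_JM hl⟩
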